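/- Let H₁, H₂ be complex Hilbert spaces, K : H₁ → H₂ a bounded linear operator, α > 0, γ ∈ (0,1], R > 0, and β = (K*K)^γ ψ with ‖ψ‖² ≤ R. Let (Ω,P) be a probability space and let K̂, K̂_m : Ω → B(H₁,H₂) and r̂ : Ω → H₂ be strongly measurable with, for r = Kβ and constants η₁, η₂, ρ, D ≥ 0 and T > 0: E‖r̂ − r‖² ≤ η₁/T, E‖K̂ − K‖²_op ≤ η₂/T, E‖r̂‖² ≤ ρ, and almost surely α I + K̂_m K̂* is invertible with ‖(α I + K̂_m K̂*)⁻¹‖_op ≤ 1/α and ‖(K̂ − K̂_m) K̂*‖²_op ≤ D α²/T. Define β̂ = (α I + K̂*K̂)⁻¹ K̂* r̂ and β̂_m = K̂*(α I + K̂_m K̂*)⁻¹ r̂, and assume ‖β̂ − β‖² and ‖β̂_m − β̂‖² are integrable. Then E‖β̂_m − β‖² ≤ 2[8(η₁ + η₂‖β‖²)/(αT) + (4Rη₂/(αT))·(α^{2γ} + α^{min(2γ,1)}·‖K*K‖^{max(2γ−1,0)}) + 4α^{2γ}R] + ρD/(2αT). -/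

import Mathlib

open MeasureTheory ContinuousLinearMap

section Resolvent

variable {E F : Type*} [NormedAddCommGroup E] [InnerProductSpace ℂ E] [CompleteSpace E]
  [NormedAddCommGroup F] [InnerProductSpace ℂ F] [CompleteSpace F]

theorem adjoint_comp_self_nonneg (L : E →L[ℂ] F) : 0 ≤ adjoint L ∘L L := by
  rw [ContinuousLinearMap.nonneg_iff_isPositive]
  exact ContinuousLinearMap.isPositive_adjoint_comp_self L

theorem isUnit_smul_one_add_adjoint_comp_self (L : E →L[ℂ] F) {α : ℝ} (hα : 0 < α) :
    IsUnit ((α : ℂ) • (1 : E →L[ℂ] E) + adjoint L ∘L L) := by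
  have h : -α ∉ spectrum ℝ (adjoint L ∘L L) := fun hmem => by
    have := spectrum_nonneg_of_nonneg (adjoint_comp_self_nonneg L) hmem
    linarith
  rw [spectrum.notMem_iff] at h
  convert h.neg using 1
  ext x
  simp [Algebra.algebraMap_eq_smul_one, add_comm]

theorem re_inner_regularized (L : E →L[ℂ] F) (α : ℝ) (u : E) :
    (inner ℂ u ((α : ℂ) • u + adjoint L (L u))).re = α * ‖u‖ ^ 2 + ‖L u‖ ^ 2 := by
  rw [inner_add_right, inner_smul_right, adjoint_inner_right, inner_self_eq_norm_sq_to_K,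
    inner_self_eq_norm_sq_to_K]
  simp [← Complex.ofReal_pow]

theorem norm_le_of_regularized_eq (L : E →L[ℂ] F) {α : ℝ} {u w : E}
    (h : (α : ℂ) • u + adjoint L (L u) = w) : α * ‖u‖ ≤ ‖w‖ := by
  have h1 := re_inner_regularized L α u
  rw [h] at h1
  have h2 := (Complex.re_le_norm _).trans (norm_inner_le_norm (𝕜 := ℂ) u w)
  rcases (norm_nonneg u).eq_or_lt with h0 | h0
  · simp [← h0]
  · refine le_of_mul_le_mul_left ?_ h0
    nlinarith [sq_nonneg ‖L u‖]

theorem norm_sq_le_of_regularized_eq_adjoint (L : E →L[ℂ] F) {α : ℝ} {u : E} {z : F}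
    (h : (α : ℂ) • u + adjoint L (L u) = adjoint L z) : 4 * α * ‖u‖ ^ 2 ≤ ‖z‖ ^ 2 := by
  have h1 := re_inner_regularized L α u
  rw [h, adjoint_inner_right] at h1
  have h2 := (Complex.re_le_norm _).trans (norm_inner_le_norm (𝕜 := ℂ) (L u) z)
  nlinarith [sq_nonneg (2 * ‖L u‖ - ‖z‖)]

theorem mul_rpow_le_rpow_mul_add {α γ x : ℝ} (hα : 0 < α) (hγ : γ ∈ Set.Ioc (0 : ℝ) 1)
    (hx : 0 ≤ x) : α * x ^ γ ≤ α ^ γ * (α + x) := by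
  have h := Real.geom_mean_le_arith_mean2_weighted hγ.1.le (sub_nonneg.2 hγ.2) hx hα.le
    (by ring)
  have h2 : α = α ^ γ * α ^ (1 - γ) := by
    rw [← Real.rpow_add hα]; simp
  have h3 : x ^ γ * α ^ (1 - γ) ≤ α + x := by
    nlinarith [hγ.1, hγ.2, mul_nonneg (sub_nonneg.2 hγ.2) hx, mul_nonneg hγ.1.le hα.le]
  calc α * x ^ γ = α ^ γ * (x ^ γ * α ^ (1 - γ)) := by
        nth_rewrite 1 [h2]; ring
    _ ≤ _ := by gcongr

theorem mul_sq_rpow_div_le {α γ x M : ℝ} (hα : 0 < α) (hγ : γ ∈ Set.Ioc (0 : ℝ) 1)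
    (hx : 0 ≤ x) (hxM : x ≤ M) :
    x * (x ^ γ / (α + x)) ^ 2 ≤
      α ^ min (2 * γ) 1 * M ^ max (2 * γ - 1) 0 / α := by
  have hs : 0 < α + x := by linarith
  have hsq : (x ^ γ) ^ 2 = x ^ (2 * γ) := by
    rw [← Real.rpow_natCast, ← Real.rpow_mul hx]; norm_num [mul_comm]
  rw [div_pow, hsq, mul_div_assoc', div_le_div_iff₀ (by positivity) hα]
  rcases le_total (2 * γ) 1 with h | h
  · rw [min_eq_left h, max_eq_right (by linarith), Real.rpow_zero, mul_one]
    have h1 := mul_rpow_le_rpow_mul_add (γ := 2 * γ) hα ⟨by linarith [hγ.1], h⟩ hx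
    calc x * x ^ (2 * γ) * α = x * (α * x ^ (2 * γ)) := by ring
      _ ≤ (α + x) * (α ^ (2 * γ) * (α + x)) := by
        gcongr
        linarith
      _ = _ := by ring
  · rw [min_eq_right h, max_eq_left (by linarith), Real.rpow_one]
    have h1 : x ^ (2 * γ) = x ^ (2 * γ - 1) * x := by
      nth_rewrite 3 [← Real.rpow_one x]
      rw [← Real.rpow_add_of_nonneg hx (by linarith) zero_le_one]
      ring_nf
    have h2 : x ^ (2 * γ - 1) ≤ M ^ (2 * γ - 1) := by gcongr
    rw [h1]
    calc x * (x ^ (2 * γ - 1) * x) * α = α * x ^ (2 * γ - 1) * x ^ 2 := by ring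
      _ ≤ α * M ^ (2 * γ - 1) * (α + x) ^ 2 := by
        have := hx.trans hxM
        gcongr
        linarith

theorem exists_regularized_source (K : E →L[ℂ] F) {α γ : ℝ} (hα : 0 < α)
    (hγ : γ ∈ Set.Ioc (0 : ℝ) 1) (ψ : E) :
    ∃ v : E, (α : ℂ) • v + adjoint K (K v) =
        cfc (fun x : ℝ => x ^ γ) (adjoint K ∘L K) ψ ∧
      ‖(α : ℂ) • v‖ ^ 2 ≤ α ^ (2 * γ) * ‖ψ‖ ^ 2 ∧
      ‖K v‖ ^ 2 ≤ α ^ min (2 * γ) 1 * ‖adjoint K ∘L K‖ ^ max (2 * γ - 1) 0 / α * ‖ψ‖ ^ 2 := by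
  set A := adjoint K ∘L K with hA
  have hA0 : 0 ≤ A := adjoint_comp_self_nonneg K
  have hAs : IsSelfAdjoint A := hA0.isSelfAdjoint
  have hspec : ∀ x ∈ spectrum ℝ A, 0 ≤ x := fun x hx => spectrum_nonneg_of_nonneg hA0 hx
  have hne : ∀ x ∈ spectrum ℝ A, α + x ≠ 0 := fun x hx => by linarith [hspec x hx]
  have hrpow : Continuous fun x : ℝ => x ^ γ :=
    Real.continuous_rpow_const hγ.1.le
  set f : ℝ → ℝ := fun x => x ^ γ / (α + x) with hf
  have hfc : ContinuousOn f (spectrum ℝ A) :=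
    hrpow.continuousOn.div (by fun_prop) hne
  set X := cfc f A with hX
  have hXs : adjoint X = X := (cfc_predicate f A : IsSelfAdjoint X)
  have hsmul : (α : ℂ) • X = cfc (fun x : ℝ => α * f x) A := by
    rw [cfc_const_mul α f A hfc]
    ext x
    simp [hX]
  have hAX : A * X = cfc (fun x : ℝ => x * f x) A := by
    rw [cfc_mul (fun x : ℝ => x) f A (by fun_prop) hfc, cfc_id' ℝ A]
  have hsum : (α : ℂ) • X + A * X = cfc (fun x : ℝ => x ^ γ) A := by
    rw [hAX, hsmul, ← cfc_add A _ _ (by fun_prop) (by fun_prop)]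
    refine cfc_congr fun x hx => ?_
    have := hne x hx
    simp only [hf]
    field_simp
  refine ⟨X ψ, by rw [← hsum]; rfl, ?_, ?_⟩
  · have h1 : ‖(α : ℂ) • X‖ ≤ α ^ γ := by
      rw [hsmul]
      refine norm_cfc_le (by positivity) fun x hx => ?_
      have hx0 := hspec x hx
      rw [Real.norm_of_nonneg (by positivity), hf, mul_div_assoc', div_le_iff₀ (by positivity)]
      exact mul_rpow_le_rpow_mul_add hα hγ hx0
    have h3 : ‖(α : ℂ) • X ψ‖ ≤ α ^ γ * ‖ψ‖ :=
      ((α : ℂ) • X).le_of_opNorm_le h1 ψ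
    calc ‖(α : ℂ) • X ψ‖ ^ 2 ≤ (α ^ γ * ‖ψ‖) ^ 2 := by gcongr
      _ = _ := by
        rw [mul_pow, ← Real.rpow_natCast (α ^ γ), ← Real.rpow_mul hα.le]
        norm_num [mul_comm]
  · have h1 : adjoint (K ∘L X) ∘L (K ∘L X) = cfc (fun x : ℝ => x * f x ^ 2) A := by
      have h2 : adjoint (K ∘L X) ∘L (K ∘L X) = X * (A * X) := by
        rw [adjoint_comp, hXs]; rfl
      rw [h2, hAX, hX, ← cfc_mul f _ A hfc (by fun_prop)]
      refine cfc_congr fun x _ => ?_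
      ring
    have h2 : ‖K ∘L X‖ ^ 2 ≤ α ^ min (2 * γ) 1 * ‖A‖ ^ max (2 * γ - 1) 0 / α := by
      rw [pow_two, ← norm_adjoint_comp_self, h1]
      refine norm_cfc_le (by positivity) fun x hx => ?_
      have hx0 := hspec x hx
      rw [Real.norm_of_nonneg (by positivity)]
      refine mul_sq_rpow_div_le hα hγ hx0 ((le_abs_self x).trans ?_)
      exact (spectrum.norm_le_norm_mul_of_mem hx).trans
        (mul_le_of_le_one_right (norm_nonneg A) norm_id_le)
    calc ‖K (X ψ)‖ ^ 2 ≤ (‖K ∘L X‖ * ‖ψ‖) ^ 2 := by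
          gcongr; exact (K ∘L X).le_opNorm ψ
      _ = ‖K ∘L X‖ ^ 2 * ‖ψ‖ ^ 2 := by ring
      _ ≤ _ := by gcongr

theorem norm_add_add_sq_le {G : Type*} [SeminormedAddCommGroup G] (a b c : G) :
    ‖a + b + c‖ ^ 2 ≤ 3 * (‖a‖ ^ 2 + ‖b‖ ^ 2 + ‖c‖ ^ 2) := by
  have h := norm_add₃_le (a := a) (b := b) (c := c)
  have h2 : ‖a + b + c‖ ^ 2 ≤ (‖a‖ + ‖b‖ + ‖c‖) ^ 2 := by gcongr
  nlinarith [sq_nonneg (‖a‖ - ‖b‖), sq_nonneg (‖b‖ - ‖c‖), sq_nonneg (‖a‖ - ‖c‖)]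

theorem regularized_inverse_apply (L : E →L[ℂ] F) {α : ℝ} (hα : 0 < α) (w : E) :
    (α : ℂ) • Ring.inverse ((α : ℂ) • (1 : E →L[ℂ] E) + adjoint L ∘L L) w +
      adjoint L (L (Ring.inverse ((α : ℂ) • (1 : E →L[ℂ] E) + adjoint L ∘L L) w)) = w :=
  DFunLike.congr_fun
    (Ring.mul_inverse_cancel _ (isUnit_smul_one_add_adjoint_comp_self L hα)) w

theorem regularized_estimator_error (K L : E →L[ℂ] F) {α : ℝ} (hα : 0 < α) (r : F)
    {v β b : E} (hv : (α : ℂ) • v + adjoint K (K v) = β)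
    (hb : (α : ℂ) • b + adjoint L (L b) = adjoint L r) :
    ‖b - β‖ ^ 2 ≤ 3 * (‖(α : ℂ) • v‖ ^ 2 +
      3 / (4 * α) * (‖r - K β‖ ^ 2 + ‖L - K‖ ^ 2 * ‖β‖ ^ 2 +
        ‖L - K‖ ^ 2 * ‖(α : ℂ) • v‖ ^ 2) +
      ‖L - K‖ ^ 2 * ‖K v‖ ^ 2) := by
  set z : F := (r - K β) + (K - L) β + (L - K) ((α : ℂ) • v) with hz
  obtain ⟨p, hp⟩ : ∃ p, (α : ℂ) • p + adjoint L (L p) = adjoint L z :=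
    ⟨_, regularized_inverse_apply L hα _⟩
  set q : E := b - β + (α : ℂ) • v - p with hq
  have hqe : (α : ℂ) • q + adjoint L (L q) = (α : ℂ) • adjoint (L - K) (K v) := by
    have h1 : (α : ℂ) • q + adjoint L (L q) =
        ((α : ℂ) • b + adjoint L (L b)) - ((α : ℂ) • β + adjoint L (L β)) +
          (α : ℂ) • ((α : ℂ) • v + adjoint L (L v)) - ((α : ℂ) • p + adjoint L (L p)) := by
      simp only [hq, map_sub, map_add, map_smul]
      module
    have h2 : (α : ℂ) • v = β - adjoint K (K v) := by rw [← hv]; abel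
    rw [h1, hp, hb, hz]
    simp only [map_sub, map_add, map_smul, sub_apply]
    rw [h2]
    module
  have hq1 : ‖q‖ ≤ ‖L - K‖ * ‖K v‖ := by
    have h1 := norm_le_of_regularized_eq L hqe
    rw [norm_smul, Complex.norm_real, Real.norm_of_nonneg hα.le] at h1
    refine (le_of_mul_le_mul_left h1 hα).trans ?_
    exact (adjoint (L - K)).le_of_opNorm_le (adjoint.norm_map (L - K)).le (K v)
  have hq2 : ‖q‖ ^ 2 ≤ ‖L - K‖ ^ 2 * ‖K v‖ ^ 2 := by
    rw [← mul_pow]; gcongr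
  have hz1 : ‖z‖ ^ 2 ≤ 3 * (‖r - K β‖ ^ 2 + ‖L - K‖ ^ 2 * ‖β‖ ^ 2 +
      ‖L - K‖ ^ 2 * ‖(α : ℂ) • v‖ ^ 2) := by
    refine (norm_add_add_sq_le _ _ _).trans ?_
    rw [← mul_pow, ← mul_pow]
    gcongr
    · rw [norm_sub_rev L K]; exact le_opNorm _ _
    · exact le_opNorm _ _
  have hp1 : ‖p‖ ^ 2 ≤ 3 / (4 * α) * (‖r - K β‖ ^ 2 + ‖L - K‖ ^ 2 * ‖β‖ ^ 2 +
      ‖L - K‖ ^ 2 * ‖(α : ℂ) • v‖ ^ 2) := by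
    have h1 := (norm_sq_le_of_regularized_eq_adjoint L hp).trans hz1
    rw [div_mul_eq_mul_div, le_div_iff₀ (by positivity)]
    linarith
  have he : b - β = -((α : ℂ) • v) + p + q := by rw [hq]; abel
  rw [he]
  refine (norm_add_add_sq_le _ _ _).trans ?_
  rw [norm_neg]
  gcongr

theorem discretized_estimator_error (L M : E →L[ℂ] F) {α : ℝ} {r y : F} {b : E}
    (hy : (α : ℂ) • y + M (adjoint L y) = r)
    (hb : (α : ℂ) • b + adjoint L (L b) = adjoint L r) :
    4 * α * ‖adjoint L y - b‖ ^ 2 ≤ (‖(L - M) ∘L adjoint L‖ * ‖y‖) ^ 2 := by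
  have h : (α : ℂ) • (adjoint L y - b) + adjoint L (L (adjoint L y - b)) =
      adjoint L (((L - M) ∘L adjoint L) y) := by
    have h1 : (α : ℂ) • (adjoint L y - b) + adjoint L (L (adjoint L y - b)) =
        adjoint L ((α : ℂ) • y + L (adjoint L y)) - ((α : ℂ) • b + adjoint L (L b)) := by
      simp only [map_sub, map_add, map_smul]
      module
    rw [h1, hb, ← hy, ← map_sub]
    simp
  refine (norm_sq_le_of_regularized_eq_adjoint L h).trans ?_
  gcongr
  exact le_opNorm _ _

end Resolvent

/-- Theorem 2 (abstract form): convergence rate of the discretized Tikhonov-regularized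
estimator `β̂_m = K̂*(α I + K̂_m K̂*)⁻¹ r̂` under the source condition `β = (K*K)^γ ψ`,
`‖ψ‖² ≤ R`, the variance bounds `E‖r̂ − r‖² ≤ η₁/T`, `E‖K̂ − K‖² ≤ η₂/T`, `E‖r̂‖² ≤ ρ`,
and the almost-sure discretization bounds `‖(α I + K̂_m K̂*)⁻¹‖ ≤ 1/α` and
`‖(K̂ − K̂_m)K̂*‖² ≤ D α²/T`. -/
theorem stmt_1 {H₁ H₂ : Type*} [NormedAddCommGroup H₁] [InnerProductSpace ℂ H₁]
    [CompleteSpace H₁] [NormedAddCommGroup H₂] [InnerProductSpace ℂ H₂] [CompleteSpace H₂]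
    (K : H₁ →L[ℂ] H₂) (α γ R : ℝ) (hα : 0 < α) (hγ : γ ∈ Set.Ioc (0 : ℝ) 1) (hR : 0 < R)
    (ψ β : H₁) (hβ : β = cfc (fun x : ℝ => x ^ γ) (adjoint K ∘L K) ψ) (hψ : ‖ψ‖ ^ 2 ≤ R)
    {Ω : Type*} [MeasurableSpace Ω] (P : Measure Ω) [IsProbabilityMeasure P]
    (Khat Khatm : Ω → (H₁ →L[ℂ] H₂)) (rhat : Ω → H₂)
    (hKhat_meas : AEStronglyMeasurable Khat P) (hKhatm_meas : AEStronglyMeasurable Khatm P)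
    (hrhat_meas : AEStronglyMeasurable rhat P)
    (η₁ η₂ ρ D T : ℝ) (hη₁ : 0 ≤ η₁) (hη₂ : 0 ≤ η₂) (hρ : 0 ≤ ρ) (hD : 0 ≤ D) (hT : 0 < T)
    (hr_int : Integrable (fun ω => ‖rhat ω - K β‖ ^ 2) P)
    (hK_int : Integrable (fun ω => ‖Khat ω - K‖ ^ 2) P)
    (hrsq_int : Integrable (fun ω => ‖rhat ω‖ ^ 2) P)
    (hr_var : ∫ ω, ‖rhat ω - K β‖ ^ 2 ∂P ≤ η₁ / T)
    (hK_var : ∫ ω, ‖Khat ω - K‖ ^ 2 ∂P ≤ η₂ / T)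
    (hr_sq : ∫ ω, ‖rhat ω‖ ^ 2 ∂P ≤ ρ)
    (has : ∀ᵐ ω ∂P,
      IsUnit ((α : ℂ) • (1 : H₂ →L[ℂ] H₂) + Khatm ω ∘L adjoint (Khat ω)) ∧
      ‖Ring.inverse ((α : ℂ) • (1 : H₂ →L[ℂ] H₂) + Khatm ω ∘L adjoint (Khat ω))‖ ≤ 1 / α ∧
      ‖(Khat ω - Khatm ω) ∘L adjoint (Khat ω)‖ ^ 2 ≤ D * α ^ 2 / T)
    (βhat βhatm : Ω → H₁)
    (hβhat : ∀ ω, βhat ω =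
      Ring.inverse ((α : ℂ) • (1 : H₁ →L[ℂ] H₁) + adjoint (Khat ω) ∘L Khat ω)
        (adjoint (Khat ω) (rhat ω)))
    (hβhatm : ∀ ω, βhatm ω =
      adjoint (Khat ω)
        (Ring.inverse ((α : ℂ) • (1 : H₂ →L[ℂ] H₂) + Khatm ω ∘L adjoint (Khat ω)) (rhat ω)))
    (hβhat_int : Integrable (fun ω => ‖βhat ω - β‖ ^ 2) P)
    (hβhatm_int : Integrable (fun ω => ‖βhatm ω - βhat ω‖ ^ 2) P) :
    ∫ ω, ‖βhatm ω - β‖ ^ 2 ∂P ≤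
      2 * (8 * (η₁ + η₂ * ‖β‖ ^ 2) / (α * T) +
          4 * R * η₂ / (α * T) *
            (α ^ (2 * γ) + α ^ min (2 * γ) 1 * ‖adjoint K ∘L K‖ ^ max (2 * γ - 1) 0) +
          4 * α ^ (2 * γ) * R) +
        ρ * D / (2 * α * T) := by
  obtain ⟨v, hv, hv1, hv2⟩ := exists_regularized_source K hα hγ ψ
  rw [← hβ] at hv
  set S := α ^ min (2 * γ) 1 * ‖adjoint K ∘L K‖ ^ max (2 * γ - 1) 0 with hS
  have hS0 : 0 ≤ S := by positivity
  have hv1' : ‖(α : ℂ) • v‖ ^ 2 ≤ α ^ (2 * γ) * R := hv1.trans (by gcongr)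
  have hv2' : ‖K v‖ ^ 2 ≤ S / α * R := hv2.trans (by gcongr)
  have key : ∀ᵐ ω ∂P, ‖βhatm ω - β‖ ^ 2 ≤
      2 * (8 / α * ‖rhat ω - K β‖ ^ 2 + (8 / α * ‖β‖ ^ 2 + 4 * R / α * (α ^ (2 * γ) + S)) *
        ‖Khat ω - K‖ ^ 2 + 4 * α ^ (2 * γ) * R) + D / (2 * α * T) * ‖rhat ω‖ ^ 2 := by
    filter_upwards [has] with ω ⟨hu, hinv, hdisc⟩
    have hb : (α : ℂ) • βhat ω + adjoint (Khat ω) (Khat ω (βhat ω)) =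
        adjoint (Khat ω) (rhat ω) := by
      rw [hβhat]
      exact regularized_inverse_apply _ hα _
    have h1 : ‖βhat ω - β‖ ^ 2 ≤ 8 / α * ‖rhat ω - K β‖ ^ 2 +
        (8 / α * ‖β‖ ^ 2 + 4 * R / α * (α ^ (2 * γ) + S)) * ‖Khat ω - K‖ ^ 2 +
          4 * α ^ (2 * γ) * R := by
      refine (regularized_estimator_error K (Khat ω) hα (rhat ω) hv hb).trans ?_
      have hc : 3 / (4 * α) = 3 / 4 * (1 / α) := by field_simp
      calc _ ≤ 3 * (α ^ (2 * γ) * R + 3 / (4 * α) * (‖rhat ω - K β‖ ^ 2 +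
              ‖Khat ω - K‖ ^ 2 * ‖β‖ ^ 2 + ‖Khat ω - K‖ ^ 2 * (α ^ (2 * γ) * R)) +
            ‖Khat ω - K‖ ^ 2 * (S / α * R)) := by gcongr
        _ ≤ _ := by
          rw [← sub_nonneg]
          have : 0 ≤ 23 / 4 * (1 / α * ‖rhat ω - K β‖ ^ 2) +
              23 / 4 * (1 / α * ‖Khat ω - K‖ ^ 2 * ‖β‖ ^ 2) +
              7 / 4 * (1 / α * ‖Khat ω - K‖ ^ 2 * (α ^ (2 * γ) * R)) +
              ‖Khat ω - K‖ ^ 2 * (S / α * R) + α ^ (2 * γ) * R := by positivity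
          refine this.trans_eq ?_
          field_simp
          ring
    have h2 : ‖βhatm ω - βhat ω‖ ^ 2 ≤ D / (4 * α * T) * ‖rhat ω‖ ^ 2 := by
      set Q := (α : ℂ) • (1 : H₂ →L[ℂ] H₂) + Khatm ω ∘L adjoint (Khat ω) with hQ
      have hy : (α : ℂ) • Ring.inverse Q (rhat ω) +
          Khatm ω (adjoint (Khat ω) (Ring.inverse Q (rhat ω))) = rhat ω :=
        DFunLike.congr_fun (Ring.mul_inverse_cancel _ hu) (rhat ω)
      have h3 := discretized_estimator_error (Khat ω) (Khatm ω) hy hb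
      rw [← hβhatm] at h3
      have h4 : ‖Ring.inverse Q (rhat ω)‖ ≤ 1 / α * ‖rhat ω‖ :=
        (Ring.inverse Q).le_of_opNorm_le hinv _
      have h5 : (‖(Khat ω - Khatm ω) ∘L adjoint (Khat ω)‖ * ‖Ring.inverse Q (rhat ω)‖) ^ 2 ≤
          D * α ^ 2 / T * (1 / α * ‖rhat ω‖) ^ 2 := by
        rw [mul_pow]; gcongr
      have h6 : D / (4 * α * T) * ‖rhat ω‖ ^ 2 =
          D * α ^ 2 / T * (1 / α * ‖rhat ω‖) ^ 2 / (4 * α) := by field_simp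
      rw [h6, le_div_iff₀ (by positivity)]
      linarith
    have h3 : ‖βhatm ω - β‖ ^ 2 ≤ 2 * (‖βhatm ω - βhat ω‖ ^ 2 + ‖βhat ω - β‖ ^ 2) := by
      have h := norm_sub_le_norm_sub_add_norm_sub (βhatm ω) (βhat ω) β
      have h' : ‖βhatm ω - β‖ ^ 2 ≤ (‖βhatm ω - βhat ω‖ + ‖βhat ω - β‖) ^ 2 := by gcongr
      exact h'.trans add_sq_le
    have h4 : D / (2 * α * T) = 2 * (D / (4 * α * T)) := by field_simp; norm_num
    rw [h4]
    linarith
  have hint1 : Integrable (fun ω => 8 / α * ‖rhat ω - K β‖ ^ 2 +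
      (8 / α * ‖β‖ ^ 2 + 4 * R / α * (α ^ (2 * γ) + S)) * ‖Khat ω - K‖ ^ 2) P :=
    (hr_int.const_mul _).add (hK_int.const_mul _)
  have hint2 : Integrable (fun ω => 2 * (8 / α * ‖rhat ω - K β‖ ^ 2 +
      (8 / α * ‖β‖ ^ 2 + 4 * R / α * (α ^ (2 * γ) + S)) * ‖Khat ω - K‖ ^ 2 +
        4 * α ^ (2 * γ) * R)) P := (hint1.add (integrable_const (4 * α ^ (2 * γ) * R))).const_mul 2
  refine (integral_mono_of_nonneg (.of_forall fun ω => by positivity)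
    (hint2.add (hrsq_int.const_mul (D / (2 * α * T)))) key).trans ?_
  rw [integral_add' hint2 (hrsq_int.const_mul _), integral_const_mul, integral_const_mul,
    integral_add hint1 (integrable_const _),
    integral_add (hr_int.const_mul _) (hK_int.const_mul _), integral_const_mul,
    integral_const_mul, integral_const, probReal_univ, one_smul]
  calc _ ≤ 2 * (8 / α * (η₁ / T) +
        (8 / α * ‖β‖ ^ 2 + 4 * R / α * (α ^ (2 * γ) + S)) * (η₂ / T) + 4 * α ^ (2 * γ) * R) +
        D / (2 * α * T) * ρ := by gcongr
    _ = _ := by field_simp; ring
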